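/- Let M be a Gotzmann set of monomials of degree t in S and set d_i = |M^i| for 0 ≤ i ≤ t (with d_{−1} = 0). If d_i^{<n−2>} ≥ d_{i−1} for some 0 ≤ i ≤ t, then M^i/x_1 is a Gotzmann set of monomials of degree t−i in S' = F[x_2,...,x_n]. -/

import Mathlib

open scoped Classical
open Finset

noncomputable section

/-- The monomials of degree `t` in `n` variables, identified with exponent vectors. -/
def degMon (n t : ℕ) : Finset (Fin n → ℕ) := Finset.Nat.antidiagonalTuple n t

/-- The exponent of `x_1` in a monomial. -/
def x1exp {n : ℕ} (m : Fin n → ℕ) : ℕ := if h : 0 < n then m ⟨0, h⟩ else 0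

/-- `lexLt u v` : `u` is lexicographically smaller than `v` as monomials
(with `x_1 > x_2 > ... > x_n`), i.e. `v > u`. -/
def lexLt {n : ℕ} (u v : Fin n → ℕ) : Prop :=
  ∃ i : Fin n, (∀ j : Fin n, j < i → u j = v j) ∧ u i < v i

/-- `M` is a lexsegment set inside the ground set `G` of monomials. -/
def IsLexSeg {n : ℕ} (G M : Finset (Fin n → ℕ)) : Prop :=
  M ⊆ G ∧ ∀ m ∈ M, ∀ v ∈ G, lexLt m v → v ∈ M

/-- The lexsegment set consisting of the top `d` monomials of `G` in the lex order. -/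
def lexSeg {n : ℕ} (G : Finset (Fin n → ℕ)) (d : ℕ) : Finset (Fin n → ℕ) :=
  G.filter (fun m => (G.filter (fun v => m = v ∨ lexLt m v)).card ≤ d)

/-- `S_1 · M` : all monomials `u * m` with `u` a variable and `m ∈ M`. -/
def S1mul (n : ℕ) (M : Finset (Fin n → ℕ)) : Finset (Fin n → ℕ) :=
  Finset.univ.biUnion (fun i : Fin n => M.image (fun m => m + Pi.single i 1))

/-- `S'_1 · M` : all monomials `x_i * m` with `2 ≤ i ≤ n` and `m ∈ M`. -/
def S1'mul (n : ℕ) (M : Finset (Fin n → ℕ)) : Finset (Fin n → ℕ) :=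
  (Finset.univ.filter (fun i : Fin n => (i : ℕ) ≠ 0)).biUnion
    (fun i => M.image (fun m => m + Pi.single i 1))

/-- `d^{<k>}` : the number of monomials obtained by multiplying each member of the
lexsegment set of `d` monomials of a fixed degree in `k+1` variables by each of the
`k+1` variables.  (We realize it in degree `d`, where the lexsegment set exists;
the number is independent of the chosen degree.  Also `0^{<k>} = 0`.) -/
def growth (d k : ℕ) : ℕ := (S1mul (k + 1) (lexSeg (degMon (k + 1) d) d)).card

/-- The monomials of `R_t` where `R = S/(x_1^a)` : degree-`t` monomials whose
`x_1`-exponent is at most `a - 1`. -/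
def RMon (n a t : ℕ) : Finset (Fin n → ℕ) :=
  (degMon n t).filter (fun m => x1exp m < a)

/-- `R_1 · M` : the monomials of `S_1 · M` not divisible by `x_1^a`. -/
def R1mul (n a : ℕ) (M : Finset (Fin n → ℕ)) : Finset (Fin n → ℕ) :=
  (S1mul n M).filter (fun m => x1exp m < a)

/-- `d_{n,t}` : the size of `R_1 · L` for the lexsegment set `L` of `d` monomials in `R_t`. -/
def dnt (n a t d : ℕ) : ℕ := (R1mul n a (lexSeg (RMon n a t) d)).card

/-- `M^i` : the monomials of `M` divisible by `x_1^i` but not by `x_1^{i+1}`. -/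
def comp {n : ℕ} (M : Finset (Fin n → ℕ)) (i : ℕ) : Finset (Fin n → ℕ) :=
  M.filter (fun m => x1exp m = i)

/-- `I(M)` : the smallest `i` such that `M^i ≠ ∅`. -/
def Imon {n : ℕ} (M : Finset (Fin n → ℕ)) : ℕ := sInf {i | (comp M i).Nonempty}

/-- `M` is Gotzmann in `S_t`. -/
def GotzmannS (n t : ℕ) (M : Finset (Fin n → ℕ)) : Prop :=
  (S1mul n (lexSeg (degMon n t) M.card)).card = (S1mul n M).card

/-- `M` is Gotzmann in `R_t`, `R = S/(x_1^a)`. -/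
def GotzmannR (n a t : ℕ) (M : Finset (Fin n → ℕ)) : Prop :=
  (R1mul n a (lexSeg (RMon n a t) M.card)).card = (R1mul n a M).card

/-- The monomials of degree `t` of `S' = F[x_2,...,x_n]`, viewed inside the `n`
variables as the monomials with `x_1`-exponent `0`. -/
def SpMon (n t : ℕ) : Finset (Fin n → ℕ) :=
  (degMon n t).filter (fun m => x1exp m = 0)

/-- `M` is Gotzmann in `S' = F[x_2,...,x_n]` (in degree `t`). -/
def GotzmannSp (n t : ℕ) (M : Finset (Fin n → ℕ)) : Prop :=
  (S1'mul n (lexSeg (SpMon n t) M.card)).card = (S1'mul n M).card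

/-- Dividing a monomial by the pure power of `x_1` it contains: set the first exponent to `0`. -/
def clearX1 {n : ℕ} (m : Fin n → ℕ) : Fin n → ℕ :=
  fun j => if (j : ℕ) = 0 then 0 else m j

/-- `M^i / x_1` : the monomials `m` of `S'` with `m * x_1^i ∈ M^i` (applied to `M = M^i`). -/
def divX1 {n : ℕ} (M : Finset (Fin n → ℕ)) : Finset (Fin n → ℕ) :=
  M.image clearX1

/-- `u · M` : the monomials `u * m` with `m ∈ M`. -/
def mulMon {n : ℕ} (u : Fin n → ℕ) (M : Finset (Fin n → ℕ)) : Finset (Fin n → ℕ) :=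
  M.image (fun m => u + m)

/-- The set `B` of degree-`t` monomials of `S` divisible by `x_1^a`. -/
def Bset (n a t : ℕ) : Finset (Fin n → ℕ) :=
  (degMon n t).filter (fun m => a ≤ x1exp m)
theorem mem_degMon {n t : ℕ} {m : Fin n → ℕ} : m ∈ degMon n t ↔ ∑ j, m j = t := by
  unfold degMon; exact Finset.Nat.mem_antidiagonalTuple

theorem lexLt_iff {n : ℕ} {u v : Fin n → ℕ} : lexLt u v ↔ toLex u < toLex v := Iff.rfl

theorem lexLt_irrefl {n : ℕ} (u : Fin n → ℕ) : ¬ lexLt u u := by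
  rw [lexLt_iff]; exact lt_irrefl _

theorem lexLt_trans {n : ℕ} {u v w : Fin n → ℕ} (h : lexLt u v) (h' : lexLt v w) : lexLt u w := by
  rw [lexLt_iff] at *; exact lt_trans h h'

theorem lexLt_tri {n : ℕ} (u v : Fin n → ℕ) : lexLt u v ∨ u = v ∨ lexLt v u := by
  simp only [lexLt_iff]
  rcases lt_trichotomy (toLex u) (toLex v) with h | h | h
  · exact Or.inl h
  · exact Or.inr (Or.inl (toLex.injective h))
  · exact Or.inr (Or.inr h)

theorem lexSeg_isLexSeg {n : ℕ} (G : Finset (Fin n → ℕ)) (d : ℕ) : IsLexSeg G (lexSeg G d) := by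
  refine ⟨Finset.filter_subset _ _, ?_⟩
  intro m hm v hv h
  simp only [lexSeg, Finset.mem_filter] at hm ⊢
  refine ⟨hv, le_trans (Finset.card_le_card ?_) hm.2⟩
  intro w hw
  simp only [Finset.mem_filter] at hw ⊢
  refine ⟨hw.1, Or.inr ?_⟩
  rcases hw.2 with rfl | h2
  · exact h
  · exact lexLt_trans h h2

theorem IsLexSeg.total {n : ℕ} {G A B : Finset (Fin n → ℕ)} (hA : IsLexSeg G A)
    (hB : IsLexSeg G B) : A ⊆ B ∨ B ⊆ A := by
  by_contra hcon
  simp only [not_or, Finset.not_subset] at hcon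
  obtain ⟨⟨a, ha, ha'⟩, b, hb, hb'⟩ := hcon
  rcases lexLt_tri a b with h | h | h
  · exact hb' (hA.2 a ha b (hB.1 hb) h)
  · exact hb' (h ▸ ha)
  · exact ha' (hB.2 b hb a (hA.1 ha) h)

theorem IsLexSeg.eq_of_card {n : ℕ} {G A B : Finset (Fin n → ℕ)} (hA : IsLexSeg G A)
    (hB : IsLexSeg G B) (h : A.card = B.card) : A = B := by
  rcases hA.total hB with h1 | h1
  · exact Finset.eq_of_subset_of_card_le h1 h.ge
  · exact (Finset.eq_of_subset_of_card_le h1 h.le).symm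

theorem exists_min {n : ℕ} (A : Finset (Fin n → ℕ)) (h : A.Nonempty) :
    ∃ a ∈ A, ∀ b ∈ A, ¬ lexLt b a := by
  obtain ⟨a, ha, h2⟩ := Finset.exists_min_image A (fun x => toLex x) h
  exact ⟨a, ha, fun b hb => by rw [lexLt_iff]; exact not_lt.2 (h2 b hb)⟩

theorem exists_max {n : ℕ} (A : Finset (Fin n → ℕ)) (h : A.Nonempty) :
    ∃ a ∈ A, ∀ b ∈ A, ¬ lexLt a b := by
  obtain ⟨a, ha, h2⟩ := Finset.exists_max_image A (fun x => toLex x) h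
  exact ⟨a, ha, fun b hb => by rw [lexLt_iff]; exact not_lt.2 (h2 b hb)⟩

/-- a lexsegment is its own lexSeg -/
theorem lexSeg_card_self {n : ℕ} {G A : Finset (Fin n → ℕ)} (hA : IsLexSeg G A) :
    lexSeg G A.card = A := by
  ext m
  simp only [lexSeg, Finset.mem_filter]
  constructor
  · rintro ⟨hm, h⟩
    by_contra hmA
    have : insert m A ⊆ G.filter (fun v => m = v ∨ lexLt m v) := by
      intro x hx
      rw [Finset.mem_insert] at hx
      rw [Finset.mem_filter]
      rcases hx with rfl | hx
      · exact ⟨hm, Or.inl rfl⟩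
      · refine ⟨hA.1 hx, ?_⟩
        rcases lexLt_tri m x with h1 | h1 | h1
        · exact Or.inr h1
        · exact Or.inl h1
        · exact absurd (hA.2 x hx m hm h1) hmA
    have := Finset.card_le_card this
    rw [Finset.card_insert_of_notMem hmA] at this
    omega
  · intro hm
    refine ⟨hA.1 hm, Finset.card_le_card ?_⟩
    intro x hx
    rw [Finset.mem_filter] at hx
    rcases hx.2 with rfl | h
    · exact hm
    · exact hA.2 m hm x hx.1 h

theorem exists_lexSeg {n : ℕ} (G : Finset (Fin n → ℕ)) (d : ℕ) (h : d ≤ G.card) :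
    ∃ A, IsLexSeg G A ∧ A.card = d := by
  induction d with
  | zero => exact ⟨∅, ⟨by simp, by simp⟩, rfl⟩
  | succ d ih =>
    obtain ⟨A, hA, hc⟩ := ih (by omega)
    have hne : (G \ A).Nonempty := by
      rw [← Finset.card_pos, Finset.card_sdiff_of_subset hA.1]; omega
    obtain ⟨a, ha, hmax⟩ := exists_max _ hne
    rw [Finset.mem_sdiff] at ha
    refine ⟨insert a A, ⟨?_, ?_⟩, by rw [Finset.card_insert_of_notMem ha.2, hc]⟩
    · exact Finset.insert_subset ha.1 hA.1
    · intro m hm v hv hl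
      rw [Finset.mem_insert] at *
      rcases hm with rfl | hm
      · by_contra hcon
        exact hmax v (Finset.mem_sdiff.2 ⟨hv, fun h => hcon (Or.inr h)⟩) hl
      · exact Or.inr (hA.2 m hm v hv hl)

theorem lexSeg_card {n : ℕ} (G : Finset (Fin n → ℕ)) (d : ℕ) (h : d ≤ G.card) :
    (lexSeg G d).card = d := by
  obtain ⟨A, hA, rfl⟩ := exists_lexSeg G d h
  rw [lexSeg_card_self hA]

theorem mem_S1mul {n : ℕ} {M : Finset (Fin n → ℕ)} {m : Fin n → ℕ} :
    m ∈ S1mul n M ↔ ∃ j, ∃ a ∈ M, a + Pi.single j 1 = m := by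
  simp [S1mul]

theorem sum_add_single {n : ℕ} (a : Fin n → ℕ) (j : Fin n) :
    ∑ k, (a + Pi.single j 1 : Fin n → ℕ) k = ∑ k, a k + 1 := by
  simp [Finset.sum_add_distrib]

theorem S1mul_subset {n t : ℕ} {M : Finset (Fin n → ℕ)} (hM : M ⊆ degMon n t) :
    S1mul n M ⊆ degMon n (t + 1) := by
  intro m hm
  obtain ⟨j, a, ha, rfl⟩ := mem_S1mul.1 hm
  have := mem_degMon.1 (hM ha)
  rw [mem_degMon, sum_add_single, this]

theorem S1mul_isLexSeg {n t : ℕ} {L : Finset (Fin n → ℕ)} (hL : IsLexSeg (degMon n t) L) :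
    IsLexSeg (degMon n (t + 1)) (S1mul n L) := by
  refine ⟨S1mul_subset hL.1, ?_⟩
  intro m hm v hv ⟨i, hi, hlt⟩
  obtain ⟨j, a, ha, rfl⟩ := mem_S1mul.1 hm
  have hne : (Finset.univ.filter (fun k => v k ≠ 0)).Nonempty :=
    ⟨i, by simp; omega⟩
  obtain ⟨k, hk, hkmax⟩ := Finset.exists_max_image _ id hne
  simp only [Finset.mem_filter, Finset.mem_univ, true_and, id] at hk hkmax
  have hik : i ≤ k := hkmax i (by omega)
  obtain ⟨b, rfl⟩ : ∃ b : Fin n → ℕ, v = b + Pi.single k 1 := by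
    refine ⟨fun l => v l - (Pi.single k 1 : Fin n → ℕ) l, ?_⟩
    ext l
    by_cases h : l = k
    · subst h; simp; omega
    · simp [h]
  refine mem_S1mul.2 ⟨k, b, ?_, rfl⟩
  have hbd : b ∈ degMon n t := by
    rw [mem_degMon, sum_add_single] at hv
    rw [mem_degMon]; omega
  have hz : ∀ l, k < l → b l = 0 := by
    intro l hl
    by_contra h
    have := hkmax l (by simp; omega)
    exact absurd hl (not_lt.2 this)
  rcases lexLt_tri a b with h | h | h
  · exact hL.2 a ha b hbd h
  · exact h ▸ ha
  · exfalso
    obtain ⟨q, hq, hqlt⟩ := h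
    have key : ∀ l, l < i → b l = a l + (if l = j then 1 else 0) := by
      intro l hl
      have := hi l hl
      have hlk : l ≠ k := (lt_of_lt_of_le hl hik).ne
      simp [Pi.single_apply, hlk] at this
      omega
    have keyi : a i + (if i = j then 1 else 0) < b i + (if i = k then 1 else 0) := by
      simpa [Pi.single_apply] using hlt
    rcases lt_trichotomy q i with h1 | h1 | h1
    · have := key q h1; omega
    · subst h1
      split_ifs at keyi with h2 h3 <;> try omega
      -- q = k, b q < a q < b q + 1
    · have h2 := hq i h1
      have h3 : i = k := by
        by_contra h3
        simp [h3] at keyi; omega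
      have h4 : ∀ l ∈ (Finset.univ : Finset (Fin n)), b l ≤ a l := by
        intro l _
        rcases le_or_gt l i with h5 | h5
        · exact (hq l (lt_of_le_of_lt h5 h1)).le
        · rw [hz l (h3 ▸ h5)]; omega
      have h5 := Finset.sum_lt_sum h4 ⟨q, Finset.mem_univ _, hqlt⟩
      rw [mem_degMon.1 hbd, mem_degMon.1 (hL.1 ha)] at h5
      omega

def ins {n : ℕ} (p : Fin (n + 1)) (i : ℕ) (x : Fin n → ℕ) : Fin (n + 1) → ℕ :=
  Fin.insertNth (α := fun _ => ℕ) p i x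

theorem ins_same {n : ℕ} (p : Fin (n + 1)) (i : ℕ) (x : Fin n → ℕ) : ins p i x p = i := by
  simp [ins]

theorem ins_succAbove {n : ℕ} (p : Fin (n + 1)) (i : ℕ) (x : Fin n → ℕ) (j : Fin n) :
    ins p i x (p.succAbove j) = x j := by
  simp [ins]

def rem {n : ℕ} (p : Fin (n + 1)) (m : Fin (n + 1) → ℕ) : Fin n → ℕ := fun j => m (p.succAbove j)

theorem ext_at {n : ℕ} (p : Fin (n + 1)) {a b : Fin (n + 1) → ℕ} (h : a p = b p)
    (h2 : ∀ j, a (p.succAbove j) = b (p.succAbove j)) : a = b := by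
  funext l
  rcases Fin.eq_self_or_eq_succAbove p l with rfl | ⟨j, rfl⟩
  · exact h
  · exact h2 j

theorem ins_rem {n : ℕ} (p : Fin (n + 1)) (m : Fin (n + 1) → ℕ) : ins p (m p) (rem p m) = m := by
  apply ext_at p
  · rw [ins_same]
  · intro j; rw [ins_succAbove]; rfl

theorem rem_ins {n : ℕ} (p : Fin (n + 1)) (i : ℕ) (x : Fin n → ℕ) : rem p (ins p i x) = x := by
  funext j; exact ins_succAbove p i x j

theorem ins_inj {n : ℕ} (p : Fin (n + 1)) (i : ℕ) {x y : Fin n → ℕ} (h : ins p i x = ins p i y) :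
    x = y := by
  rw [← rem_ins p i x, h, rem_ins]

theorem ins_mem {n t : ℕ} (p : Fin (n + 1)) (i : ℕ) (x : Fin n → ℕ) :
    ins p i x ∈ degMon (n + 1) t ↔ i + ∑ j, x j = t := by
  rw [mem_degMon, Fin.sum_univ_succAbove _ p, ins_same]
  simp only [ins_succAbove]

theorem ins_lex {n : ℕ} (p : Fin (n + 1)) (i : ℕ) {x y : Fin n → ℕ} (h : lexLt x y) :
    lexLt (ins p i x) (ins p i y) := by
  obtain ⟨k, hk, hlt⟩ := h
  refine ⟨p.succAbove k, ?_, by simpa only [ins_succAbove] using hlt⟩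
  intro l hl
  rcases Fin.eq_self_or_eq_succAbove p l with rfl | ⟨j, rfl⟩
  · rw [ins_same, ins_same]
  · rw [ins_succAbove, ins_succAbove]
    exact hk j ((Fin.strictMono_succAbove p).lt_iff_lt.1 hl)

theorem ins_lex' {n : ℕ} (p : Fin (n + 1)) (i : ℕ) {x y : Fin n → ℕ}
    (h : lexLt (ins p i x) (ins p i y)) : lexLt x y := by
  rcases lexLt_tri x y with h1 | rfl | h1
  · exact h1
  · exact absurd h (lexLt_irrefl _)
  · exact absurd (lexLt_trans h (ins_lex p i h1)) (lexLt_irrefl _)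

theorem ins_add_self {n : ℕ} (p : Fin (n + 1)) (i : ℕ) (x : Fin n → ℕ) :
    ins p i x + Pi.single p 1 = ins p (i + 1) x := by
  apply ext_at p
  · simp [ins_same]
  · intro j; simp [ins_succAbove, Fin.succAbove_ne]

theorem ins_add_ne {n : ℕ} (p : Fin (n + 1)) (i : ℕ) (x : Fin n → ℕ) (j : Fin n) :
    ins p i x + Pi.single (p.succAbove j) 1 = ins p i (x + Pi.single j 1) := by
  apply ext_at p
  · simp [ins_same, (Fin.succAbove_ne p j).symm]
  · intro k
    simp [ins_succAbove, Pi.single_apply]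

def slc {n : ℕ} (p : Fin (n + 1)) (M : Finset (Fin (n + 1) → ℕ)) (i : ℕ) : Finset (Fin n → ℕ) :=
  (M.filter (fun m => m p = i)).image (rem p)

theorem mem_slc {n : ℕ} {p : Fin (n + 1)} {M : Finset (Fin (n + 1) → ℕ)} {i : ℕ}
    {x : Fin n → ℕ} : x ∈ slc p M i ↔ ins p i x ∈ M := by
  simp only [slc, Finset.mem_image, Finset.mem_filter]
  constructor
  · rintro ⟨m, ⟨hm, rfl⟩, rfl⟩
    rwa [ins_rem]
  · intro h
    exact ⟨_, ⟨h, ins_same _ _ _⟩, rem_ins _ _ _⟩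

theorem slc_card {n : ℕ} (p : Fin (n + 1)) (M : Finset (Fin (n + 1) → ℕ)) (i : ℕ) :
    (slc p M i).card = (M.filter (fun m => m p = i)).card := by
  apply Finset.card_image_of_injOn
  intro a ha b hb hab
  simp only [Finset.coe_filter, Set.mem_ofPred_eq] at ha hb
  rw [← ins_rem p a, ← ins_rem p b, hab, ha.2, hb.2]

theorem le_of_mem {n t : ℕ} {m : Fin n → ℕ} (p : Fin n) (h : m ∈ degMon n t) : m p ≤ t := by
  rw [mem_degMon] at h
  rw [← h]
  exact Finset.single_le_sum (f := m) (fun _ _ => Nat.zero_le _) (Finset.mem_univ p)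

theorem card_eq_slcs {n t : ℕ} (p : Fin (n + 1)) {M : Finset (Fin (n + 1) → ℕ)}
    (hM : M ⊆ degMon (n + 1) t) : M.card = ∑ i ∈ Finset.range (t + 1), (slc p M i).card := by
  simp only [slc_card]
  apply Finset.card_eq_sum_card_fiberwise
  intro m hm
  have := le_of_mem p (hM hm)
  simp; omega

theorem slc_subset {n t : ℕ} (p : Fin (n + 1)) {M : Finset (Fin (n + 1) → ℕ)}
    (hM : M ⊆ degMon (n + 1) t) (i : ℕ) : slc p M i ⊆ degMon n (t - i) := by
  intro x hx
  have := (ins_mem p i x).1 (hM (mem_slc.1 hx))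
  rw [mem_degMon]; omega

theorem slc_gt {n t : ℕ} (p : Fin (n + 1)) {M : Finset (Fin (n + 1) → ℕ)}
    (hM : M ⊆ degMon (n + 1) t) {i : ℕ} (h : t < i) : slc p M i = ∅ := by
  rw [Finset.eq_empty_iff_forall_notMem]
  intro x hx
  have := (ins_mem p i x).1 (hM (mem_slc.1 hx))
  omega

theorem slc_S1mul_zero {n : ℕ} (p : Fin (n + 1)) (M : Finset (Fin (n + 1) → ℕ)) :
    slc p (S1mul (n + 1) M) 0 = S1mul n (slc p M 0) := by
  ext x
  rw [mem_slc, mem_S1mul, mem_S1mul]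
  constructor
  · rintro ⟨j, a, ha, h⟩
    rcases Fin.eq_self_or_eq_succAbove p j with rfl | ⟨k, rfl⟩
    · have := congrFun h j
      simp [ins_same] at this
    · rw [← ins_rem p a, ins_add_ne] at h
      have h1 := congrFun h p
      rw [ins_same, ins_same] at h1
      rw [h1] at h
      refine ⟨k, rem p a, ?_, ins_inj p _ h⟩
      rw [mem_slc, ← h1, ins_rem]; exact ha
  · rintro ⟨j, a, ha, rfl⟩
    exact ⟨_, _, mem_slc.1 ha, ins_add_ne p 0 a j⟩

theorem slc_S1mul_succ {n : ℕ} (p : Fin (n + 1)) (M : Finset (Fin (n + 1) → ℕ)) (i : ℕ) :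
    slc p (S1mul (n + 1) M) (i + 1) = S1mul n (slc p M (i + 1)) ∪ slc p M i := by
  ext x
  rw [mem_slc, Finset.mem_union, mem_S1mul, mem_S1mul]
  constructor
  · rintro ⟨j, a, ha, h⟩
    rcases Fin.eq_self_or_eq_succAbove p j with rfl | ⟨k, rfl⟩
    · right
      rw [mem_slc]
      rw [← ins_add_self] at h
      rw [← add_right_cancel h]; exact ha
    · left
      rw [← ins_rem p a, ins_add_ne] at h
      have h1 := congrFun h p
      rw [ins_same, ins_same] at h1
      rw [h1] at h
      refine ⟨k, rem p a, ?_, ins_inj p _ h⟩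
      rw [mem_slc, ← h1, ins_rem]; exact ha
  · rintro (⟨j, a, ha, rfl⟩ | h)
    · exact ⟨_, _, mem_slc.1 ha, ins_add_ne p _ a j⟩
    · exact ⟨p, _, mem_slc.1 h, ins_add_self p i x⟩

/-- compression -/
def cmpr {n : ℕ} (p : Fin (n + 1)) (t : ℕ) (M : Finset (Fin (n + 1) → ℕ)) :
    Finset (Fin (n + 1) → ℕ) :=
  (degMon (n + 1) t).filter
    (fun m => rem p m ∈ lexSeg (degMon n (t - m p)) (slc p M (m p)).card)

theorem cmpr_subset {n : ℕ} (p : Fin (n + 1)) (t : ℕ) (M : Finset (Fin (n + 1) → ℕ)) :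
    cmpr p t M ⊆ degMon (n + 1) t := Finset.filter_subset _ _

theorem lexSeg_zero {n : ℕ} (G : Finset (Fin n → ℕ)) : lexSeg G 0 = ∅ :=
  lexSeg_card_self (A := ∅) ⟨by simp, by simp⟩

theorem slc_cmpr {n t : ℕ} (p : Fin (n + 1)) {M : Finset (Fin (n + 1) → ℕ)}
    (hM : M ⊆ degMon (n + 1) t) (i : ℕ) :
    slc p (cmpr p t M) i = lexSeg (degMon n (t - i)) (slc p M i).card := by
  rcases lt_or_ge t i with h | h
  · rw [slc_gt p (cmpr_subset p t M) h, slc_gt p hM h, Finset.card_empty, lexSeg_zero]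
  · ext x
    rw [mem_slc, cmpr, Finset.mem_filter, ins_same, rem_ins, ins_mem]
    constructor
    · exact fun h => h.2
    · intro hx
      refine ⟨?_, hx⟩
      have := mem_degMon.1 ((lexSeg_isLexSeg _ _).1 hx)
      omega

theorem slc_cmpr_card {n t : ℕ} (p : Fin (n + 1)) {M : Finset (Fin (n + 1) → ℕ)}
    (hM : M ⊆ degMon (n + 1) t) (i : ℕ) :
    (slc p (cmpr p t M) i).card = (slc p M i).card := by
  rw [slc_cmpr p hM, lexSeg_card]
  exact Finset.card_le_card (slc_subset p hM i)

theorem cmpr_card {n t : ℕ} (p : Fin (n + 1)) {M : Finset (Fin (n + 1) → ℕ)}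
    (hM : M ⊆ degMon (n + 1) t) : (cmpr p t M).card = M.card := by
  rw [card_eq_slcs p hM, card_eq_slcs p (cmpr_subset p t M)]
  exact Finset.sum_congr rfl (fun i _ => slc_cmpr_card p hM i)

def Mac (n : ℕ) : Prop := ∀ (t : ℕ) (M : Finset (Fin n → ℕ)), M ⊆ degMon n t →
  (S1mul n (lexSeg (degMon n t) M.card)).card ≤ (S1mul n M).card

theorem S1mul_empty (n : ℕ) : S1mul n ∅ = ∅ := by
  ext x; simp [mem_S1mul]

/-- the slices of the shadow of a compression -/
theorem slc_S1_cmpr {n t : ℕ} (p : Fin (n + 1)) {M : Finset (Fin (n + 1) → ℕ)}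
    (hM : M ⊆ degMon (n + 1) t) (i : ℕ) :
    (slc p (S1mul (n + 1) (cmpr p t M)) i).card =
      max (S1mul n (lexSeg (degMon n (t - i)) (slc p M i).card)).card
        (if i = 0 then 0 else (slc p M (i - 1)).card) := by
  rcases i with _ | i
  · rw [slc_S1mul_zero, slc_cmpr p hM]; simp
  · rw [slc_S1mul_succ, slc_cmpr p hM]
    simp only [Nat.add_sub_cancel, Nat.add_eq_zero_iff, one_ne_zero, and_false, if_false]
    rw [← slc_cmpr_card p hM i]
    rcases lt_or_ge t (i + 1) with h | h
    · rw [slc_gt p hM h]; simp [lexSeg_zero, S1mul_empty]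
    · have h1 := S1mul_isLexSeg (lexSeg_isLexSeg (degMon n (t - (i + 1))) (slc p M (i + 1)).card)
      have h2 := lexSeg_isLexSeg (degMon n (t - i)) (slc p M i).card
      rw [show t - (i + 1) + 1 = t - i by omega] at h1
      rw [← slc_cmpr p hM i] at h2
      rcases h1.total h2 with h3 | h3
      · rw [Finset.union_eq_right.2 h3, max_eq_right (Finset.card_le_card h3)]
      · rw [Finset.union_eq_left.2 h3, max_eq_left (Finset.card_le_card h3)]

theorem slc_S1_ge {n t : ℕ} (hmac : Mac n) (p : Fin (n + 1)) {M : Finset (Fin (n + 1) → ℕ)}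
    (hM : M ⊆ degMon (n + 1) t) (i : ℕ) :
    (slc p (S1mul (n + 1) (cmpr p t M)) i).card ≤ (slc p (S1mul (n + 1) M) i).card := by
  rw [slc_S1_cmpr p hM]
  have h := hmac _ _ (slc_subset p hM i)
  rcases i with _ | i
  · rw [slc_S1mul_zero]; simpa using h
  · rw [slc_S1mul_succ]
    refine max_le (h.trans (Finset.card_le_card Finset.subset_union_left)) ?_
    simp only [Nat.add_sub_cancel, Nat.add_eq_zero_iff, one_ne_zero, and_false, if_false]
    exact Finset.card_le_card Finset.subset_union_right

theorem S1_cmpr_le {n t : ℕ} (hmac : Mac n) (p : Fin (n + 1)) {M : Finset (Fin (n + 1) → ℕ)}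
    (hM : M ⊆ degMon (n + 1) t) :
    (S1mul (n + 1) (cmpr p t M)).card ≤ (S1mul (n + 1) M).card := by
  rw [card_eq_slcs p (S1mul_subset hM), card_eq_slcs p (S1mul_subset (cmpr_subset p t M))]
  exact Finset.sum_le_sum (fun i _ => slc_S1_ge hmac p hM i)

/-- slicewise equality -/
theorem slc_S1_eq {n t : ℕ} (hmac : Mac n) (p : Fin (n + 1)) {M : Finset (Fin (n + 1) → ℕ)}
    (hM : M ⊆ degMon (n + 1) t)
    (h : (S1mul (n + 1) M).card ≤ (S1mul (n + 1) (cmpr p t M)).card) (i : ℕ) (hi : i ≤ t + 1) :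
    (slc p (S1mul (n + 1) (cmpr p t M)) i).card = (slc p (S1mul (n + 1) M) i).card := by
  have h' := le_antisymm h (S1_cmpr_le hmac p hM)
  rw [card_eq_slcs p (S1mul_subset hM), card_eq_slcs p (S1mul_subset (cmpr_subset p t M))] at h'
  exact (Finset.sum_eq_sum_iff_of_le (fun i _ => slc_S1_ge hmac p hM i)).1 h'.symm i
    (by simp; omega)

def ColLt {n : ℕ} (M N : Finset (Fin n → ℕ)) : Prop :=
  ∃ a ∈ N, a ∉ M ∧ ∀ b ∈ M, b ∉ N → lexLt b a

theorem exists_colMax {n : ℕ} (F : Finset (Finset (Fin n → ℕ))) (h : F.Nonempty) :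
    ∃ M ∈ F, ∀ N ∈ F, ¬ ColLt M N := by
  obtain ⟨M, hM, hmax⟩ := Finset.exists_max_image F
    (fun M => toColex (M.map (toLex (α := Fin n → ℕ)).toEmbedding)) h
  refine ⟨M, hM, ?_⟩
  rintro N hN ⟨a, ha, ha', hb⟩
  refine absurd (hmax N hN) (not_le.2 ?_)
  rw [Finset.Colex.lt_iff_exists_forall_lt]
  refine ⟨toLex a, ?_, ?_, ?_⟩
  · simpa using ha
  · simpa using ha'
  · intro b hbM hbN
    simp only [ofColex_toColex, Finset.mem_map_equiv, toLex_symm_eq] at hbM hbN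
    exact hb _ hbM hbN

theorem cmpr_colLt {n t : ℕ} (p : Fin (n + 1)) {M : Finset (Fin (n + 1) → ℕ)}
    (hM : M ⊆ degMon (n + 1) t) (hne : cmpr p t M ≠ M) : ColLt M (cmpr p t M) := by
  have hc := cmpr_card p hM
  have h1 : (cmpr p t M \ M).Nonempty := by
    rw [Finset.sdiff_nonempty]
    intro h
    exact hne (Finset.eq_of_subset_of_card_le h hc.ge)
  obtain ⟨a, ha, hmax⟩ := exists_max _ h1
  rw [Finset.mem_sdiff] at ha
  refine ⟨a, ha.1, ha.2, ?_⟩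
  intro b hb hb'
  have hs := slc_cmpr_card p hM (b p)
  have hbs : rem p b ∈ slc p M (b p) := by rw [mem_slc, ins_rem]; exact hb
  have hbs' : rem p b ∉ slc p (cmpr p t M) (b p) := by rw [mem_slc, ins_rem]; exact hb'
  have h2 : (slc p (cmpr p t M) (b p) \ slc p M (b p)).Nonempty := by
    rw [Finset.sdiff_nonempty]
    intro h
    exact hbs' (Finset.eq_of_subset_of_card_le h hs.ge ▸ hbs)
  obtain ⟨x, hx⟩ := h2
  rw [Finset.mem_sdiff] at hx
  have hl : IsLexSeg (degMon n (t - b p)) (slc p (cmpr p t M) (b p)) := by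
    rw [slc_cmpr p hM]; exact lexSeg_isLexSeg _ _
  have hbx : lexLt b (ins p (b p) x) := by
    have : lexLt (rem p b) x := by
      rcases lexLt_tri (rem p b) x with h | h | h
      · exact h
      · exact absurd (h ▸ hx.1) hbs'
      · exact absurd (hl.2 x hx.1 _ (slc_subset p hM _ hbs) h) hbs'
    have := ins_lex p (b p) this
    rwa [ins_rem] at this
  have h3 := hmax (ins p (b p) x) (Finset.mem_sdiff.2
    ⟨mem_slc.1 hx.1, fun h => hx.2 (mem_slc.2 h)⟩)
  rcases lexLt_tri a (ins p (b p) x) with h | h | h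
  · exact absurd h h3
  · rw [h]; exact hbx
  · exact lexLt_trans hbx h

/-- in a compressed set, larger monomials sharing the `p`-exponent belong to the set -/
theorem cmpr_closed {n t : ℕ} (p : Fin (n + 1)) {M : Finset (Fin (n + 1) → ℕ)}
    (hM : M ⊆ degMon (n + 1) t) (he : cmpr p t M = M) {v u : Fin (n + 1) → ℕ} (hv : v ∈ M)
    (hu : u ∈ degMon (n + 1) t) (h : lexLt v u) (hp : u p = v p) : u ∈ M := by
  have hl : IsLexSeg (degMon n (t - v p)) (slc p M (v p)) := by
    rw [← he, slc_cmpr p (he.symm ▸ hM)]; exact lexSeg_isLexSeg _ _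
  have h1 : rem p v ∈ slc p M (v p) := by rw [mem_slc, ins_rem]; exact hv
  have h2 : rem p u ∈ degMon n (t - v p) := by
    rw [← ins_rem p u, ins_mem, hp] at hu
    rw [mem_degMon]; omega
  have h3 : lexLt (rem p v) (rem p u) := by
    apply ins_lex' p (v p)
    rw [ins_rem, ← hp, ins_rem]; exact h
  have := hl.2 _ h1 _ h2 h3
  rwa [mem_slc, ← hp, ins_rem] at this

theorem lexLt_of_zero {n : ℕ} {u v : Fin (n + 1) → ℕ} (h : u 0 < v 0) : lexLt u v :=
  ⟨0, fun j hj => absurd hj (Fin.not_lt_zero j), h⟩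

theorem zero_le_of_lexLt {n : ℕ} {u v : Fin (n + 1) → ℕ} (h : lexLt u v) : u 0 ≤ v 0 := by
  by_contra hc
  exact lexLt_irrefl _ (lexLt_trans h (lexLt_of_zero (not_le.1 hc)))

/-- moving one unit to a smaller index increases -/
theorem lexLt_move {n : ℕ} {a b : Fin n → ℕ} {j k : Fin n} (hjk : j < k)
    (h : a + Pi.single j 1 = b + Pi.single k 1) : lexLt a b := by
  refine ⟨j, ?_, ?_⟩
  · intro l hl
    have := congrFun h l
    simpa [Pi.single_apply, hl.ne, (hl.trans hjk).ne] using this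
  · have := congrFun h j
    simp [hjk.ne] at this
    omega

theorem exists_sub {n : ℕ} (u : Fin n → ℕ) (j k : Fin n) (hk : u k ≠ 0) :
    ∃ b : Fin n → ℕ, u + Pi.single j 1 = b + Pi.single k 1 := by
  refine ⟨fun l => (u + Pi.single j 1 : Fin n → ℕ) l - (Pi.single k 1 : Fin n → ℕ) l, ?_⟩
  funext l
  by_cases h : l = k
  · subst h; simp; omega
  · simp [h]

theorem mac_step {n : ℕ} (hmac : Mac (n + 2)) : Mac (n + 3) := by
  intro t M0 hM0
  set F := ((degMon (n + 3) t).powerset.filter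
    (fun M => M.card = M0.card ∧ (S1mul (n + 3) M).card ≤ (S1mul (n + 3) M0).card)) with hF
  obtain ⟨M, hMF, hmax⟩ := exists_colMax F ⟨M0, by simp [hF, hM0]⟩
  have hFm : ∀ N, N ∈ F ↔ N ⊆ degMon (n + 3) t ∧ N.card = M0.card ∧
      (S1mul (n + 3) N).card ≤ (S1mul (n + 3) M0).card := by
    intro N; simp [hF]
  obtain ⟨hM, hcard, hS⟩ := (hFm M).1 hMF
  have hcm : ∀ p, cmpr p t M = M := by
    intro p
    by_contra hne
    refine hmax _ ((hFm _).2 ⟨cmpr_subset _ _ _, ?_, ?_⟩) (cmpr_colLt p hM hne)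
    · rw [cmpr_card p hM, hcard]
    · exact (S1_cmpr_le hmac p hM).trans hS
  suffices hlex : IsLexSeg (degMon (n + 3) t) M by
    rw [← hcard, lexSeg_card_self hlex]; exact hS
  refine ⟨hM, ?_⟩
  by_contra hcon
  push Not at hcon
  obtain ⟨v0, hv0, u0, hu0, hlt0, hu0'⟩ := hcon
  obtain ⟨v, hv, hvmin⟩ := exists_min M ⟨v0, hv0⟩
  obtain ⟨u, hu, humax⟩ := exists_max (degMon (n + 3) t \ M) ⟨u0, by simp [hu0, hu0']⟩
  rw [Finset.mem_sdiff] at hu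
  have humax' : ∀ w ∈ degMon (n + 3) t, lexLt u w → w ∈ M := by
    intro w hw h
    by_contra hc
    exact humax w (Finset.mem_sdiff.2 ⟨hw, hc⟩) h
  have hvu0 : lexLt v u0 := by
    rcases lexLt_tri v v0 with h | h | h
    · exact lexLt_trans h hlt0
    · rw [h]; exact hlt0
    · exact absurd h (hvmin v0 hv0)
  have hvu : lexLt v u := by
    rcases lexLt_tri u0 u with h | h | h
    · exact lexLt_trans hvu0 h
    · rw [← h]; exact hvu0
    · exact absurd h (humax u0 (by simp [hu0, hu0']))
  have hne : ∀ p, u p ≠ v p := fun p hp => hu.2 (cmpr_closed p hM (hcm p) hv hu.1 hvu hp)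
  have h0 : v 0 < u 0 := lt_of_le_of_ne (zero_le_of_lexLt hvu) (hne 0).symm
  set z : Fin (n + 3) := Fin.last _ with hz
  have huz : u z ≠ 0 := by
    intro huz
    have hvz : v z ≠ 0 := fun h => hne z (by rw [huz, h])
    -- move the last exponent of v
    set y : Fin (n + 3) := ⟨n + 1, by omega⟩ with hy
    have hyz : y < z := by simp [hy, hz, Fin.lt_def]
    have hy0 : y ≠ 0 := by simp [hy, Fin.ext_iff]
    have hz0 : z ≠ 0 := by simp [hz, Fin.ext_iff]
    set w : Fin (n + 3) → ℕ := Function.update (Function.update v z 0) y (v y + v z) with hw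
    have hwz : w z = 0 := by simp [hw, hyz.ne']
    have hwy : w y = v y + v z := by simp [hw]
    have hwo : ∀ l, l ≠ y → l ≠ z → w l = v l := by
      intro l h1 h2; simp [hw, h1, h2]
    have hwd : w ∈ degMon (n + 3) t := by
      have := mem_degMon.1 (hM hv)
      rw [mem_degMon, ← this]
      rw [← Finset.add_sum_erase _ w (Finset.mem_univ z),
        ← Finset.add_sum_erase _ v (Finset.mem_univ z),
        ← Finset.add_sum_erase _ w (show y ∈ Finset.univ.erase z by simp [hyz.ne]),
        ← Finset.add_sum_erase _ v (show y ∈ Finset.univ.erase z by simp [hyz.ne]),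
        hwz, hwy]
      have e : ∑ x ∈ (Finset.univ.erase z).erase y, w x = ∑ x ∈ (Finset.univ.erase z).erase y, v x :=
        Finset.sum_congr rfl (fun l hl => hwo l (by simp at hl; exact hl.1)
          (by simp at hl; exact hl.2))
      rw [e]
      ring
    have hvw : lexLt v w := by
      refine ⟨y, fun l hl => (hwo l hl.ne (hl.trans hyz).ne).symm, by omega⟩
    have hw0 : w 0 = v 0 := hwo 0 hy0.symm hz0.symm
    have hwM : w ∈ M := cmpr_closed 0 hM (hcm 0) hv hwd hvw hw0
    exact hu.2 (cmpr_closed z hM (hcm z) hwM hu.1 (lexLt_of_zero (by omega)) (by rw [huz, hwz]))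
  -- swap
  have hvu' : u ≠ v := fun h => hne 0 (by rw [h])
  set M' := insert u (M.erase v) with hM'
  have hu_er : u ∉ M.erase v := fun h => hu.2 (Finset.mem_of_mem_erase h)
  have hcol : ColLt M M' := by
    refine ⟨u, by simp [hM'], hu.2, ?_⟩
    intro b hb hb'
    have : b = v := by
      by_contra h
      exact hb' (by simp [hM', hb, h])
    rw [this]; exact hvu
  refine hmax M' ((hFm _).2 ⟨?_, ?_, ?_⟩) hcol
  · exact Finset.insert_subset hu.1 ((Finset.erase_subset _ _).trans hM)
  · rw [hM', Finset.card_insert_of_notMem hu_er, Finset.card_erase_of_mem hv, ← hcard]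
    have := Finset.card_pos.2 ⟨v, hv⟩
    omega
  · refine le_trans ?_ hS
    have hsub : S1mul (n + 3) M' ⊆
        insert (u + Pi.single z 1) ((S1mul (n + 3) M).erase (v + Pi.single z 1)) := by
      intro m hm
      have hmv : m ≠ v + Pi.single z 1 := by
        rintro rfl
        obtain ⟨j, a, ha, h⟩ := mem_S1mul.1 hm
        rcases eq_or_lt_of_le (Fin.le_last j) with h1 | h1
        · rw [h1] at h
          have h2 := add_right_cancel h
          rw [h2] at ha
          simp [hM', hvu'.symm] at ha
        · have h2 := lexLt_move h1 h
          rw [hM', Finset.mem_insert] at ha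
          rcases ha with rfl | ha
          · exact lexLt_irrefl _ (lexLt_trans h2 hvu)
          · exact hvmin a (Finset.mem_of_mem_erase ha) h2
      rw [Finset.mem_insert, Finset.mem_erase]
      obtain ⟨j, a, ha, h⟩ := mem_S1mul.1 hm
      rw [hM', Finset.mem_insert] at ha
      rcases ha with rfl | ha
      · rcases eq_or_lt_of_le (Fin.le_last j) with h1 | h1
        · left; rw [← h, h1]
        · right
          refine ⟨hmv, ?_⟩
          obtain ⟨b, hb⟩ := exists_sub a j z huz
          have h2 := lexLt_move h1 hb
          have h3 : b ∈ degMon (n + 3) t := by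
            have e := congrArg (fun f => ∑ k, f k) hb
            simp only [sum_add_single] at e
            have := mem_degMon.1 hu.1
            rw [mem_degMon]; omega
          exact mem_S1mul.2 ⟨z, b, humax' b h3 h2, by rw [← hb, h]⟩
      · right
        exact ⟨hmv, mem_S1mul.2 ⟨j, a, Finset.mem_of_mem_erase ha, h⟩⟩
    refine (Finset.card_le_card hsub).trans ((Finset.card_insert_le _ _).trans ?_)
    have hin : v + Pi.single z 1 ∈ S1mul (n + 3) M := mem_S1mul.2 ⟨z, v, hv, rfl⟩
    rw [Finset.card_erase_of_mem hin]
    have := Finset.card_pos.2 ⟨_, hin⟩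
    omega

theorem mac_zero : Mac 0 := by
  intro t M _
  simp [S1mul]

theorem mac_one : Mac 1 := by
  intro t M hM
  have : IsLexSeg (degMon 1 t) M := by
    refine ⟨hM, ?_⟩
    intro m hm v hv _
    have h1 := mem_degMon.1 (hM hm)
    have h2 := mem_degMon.1 hv
    simp at h1 h2
    have : v = m := by
      funext j; rw [Subsingleton.elim j 0]; omega
    rwa [this]
  rw [lexSeg_card_self this]

theorem mac_two : Mac 2 := by
  intro t M hM
  rcases Finset.eq_empty_or_nonempty M with rfl | hne
  · simp [lexSeg_zero, S1mul_empty]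
  have hinj : Function.Injective (fun m : Fin 2 → ℕ => m + Pi.single 0 1) :=
    fun a b h => add_right_cancel h
  have hdeg : ∀ m ∈ degMon 2 t, m 0 + m 1 = t := by
    intro m hm
    have := mem_degMon.1 hm
    simpa [Fin.sum_univ_two] using this
  have hge : M.card + 1 ≤ (S1mul 2 M).card := by
    obtain ⟨v, hv, hmin⟩ := exists_min M hne
    have hni : v + Pi.single 1 1 ∉ M.image (fun m => m + Pi.single 0 1) := by
      intro h
      obtain ⟨a, ha, h⟩ := Finset.mem_image.1 h
      exact hmin a ha (lexLt_move (by decide) h)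
    rw [← Finset.card_image_of_injective M hinj, ← Finset.card_insert_of_notMem hni]
    apply Finset.card_le_card
    intro x hx
    rw [Finset.mem_insert] at hx
    rcases hx with rfl | hx
    · exact mem_S1mul.2 ⟨1, v, hv, rfl⟩
    · obtain ⟨a, ha, h⟩ := Finset.mem_image.1 hx
      exact mem_S1mul.2 ⟨0, a, ha, h⟩
  refine le_trans ?_ hge
  have hLc := lexSeg_card (degMon 2 t) M.card (Finset.card_le_card hM)
  have hL := lexSeg_isLexSeg (degMon 2 t) M.card
  set L := lexSeg (degMon 2 t) M.card
  obtain ⟨v, hv, hmin⟩ := exists_min L (by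
    rw [← Finset.card_pos, hLc]; exact Finset.card_pos.2 hne)
  rw [← hLc, ← Finset.card_image_of_injective L hinj]
  refine le_trans (Finset.card_le_card ?_) (Finset.card_insert_le (v + Pi.single 1 1) _)
  intro x hx
  obtain ⟨j, a, ha, h⟩ := mem_S1mul.1 hx
  rw [Finset.mem_insert, Finset.mem_image]
  have hj : j = 0 ∨ j = 1 := by fin_cases j <;> simp
  rcases hj with rfl | rfl
  · exact Or.inr ⟨a, ha, h⟩
  · by_cases hav : a = v
    · left; rw [← h, hav]
    · right
      have h1 := hdeg a (hL.1 ha)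
      have h2 := hdeg v (hL.1 hv)
      have h3 : v 0 < a 0 := by
        have h4 : lexLt v a := by
          rcases lexLt_tri v a with h | h | h
          · exact h
          · exact absurd h.symm hav
          · exact absurd h (hmin a ha)
        refine lt_of_le_of_ne (zero_le_of_lexLt h4) ?_
        intro h5
        apply hav
        funext k
        fin_cases k
        · exact h5.symm
        · simp; omega
      obtain ⟨b, hb⟩ := exists_sub a 1 0 (by omega)
      have hb0 := congrFun hb 0
      have hb1 := congrFun hb 1
      simp at hb0 hb1
      have hbd : b ∈ degMon 2 t := by
        rw [mem_degMon, Fin.sum_univ_two]; omega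
      refine ⟨b, ?_, by rw [← hb, h]⟩
      rcases lexLt_tri v b with h6 | h6 | h6
      · exact hL.2 v hv b hbd h6
      · rwa [← h6]
      · have := zero_le_of_lexLt h6
        have : b = v := by
          funext k
          fin_cases k
          · simp; omega
          · simp; omega
        rwa [this]

theorem mac_all : ∀ n, Mac n
  | 0 => mac_zero
  | 1 => mac_one
  | 2 => mac_two
  | n + 3 => mac_step (mac_all (n + 2))

theorem S1mul_image_add {n : ℕ} (A : Finset (Fin n → ℕ)) (c : Fin n → ℕ) :
    S1mul n (A.image (fun m => m + c)) = (S1mul n A).image (fun m => m + c) := by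
  ext x
  simp only [mem_S1mul, Finset.mem_image]
  constructor
  · rintro ⟨j, _, ⟨a, ha, rfl⟩, rfl⟩
    exact ⟨_, ⟨j, a, ha, rfl⟩, add_right_comm _ _ _⟩
  · rintro ⟨_, ⟨j, a, ha, rfl⟩, rfl⟩
    exact ⟨j, _, ⟨a, ha, rfl⟩, add_right_comm _ _ _⟩

theorem shift_inj {n : ℕ} (c : Fin n → ℕ) : Function.Injective (fun m : Fin n → ℕ => m + c) :=
  fun _ _ h => add_right_cancel h

theorem shift_isLexSeg {n s : ℕ} {A : Finset (Fin (n + 1) → ℕ)}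
    (hA : IsLexSeg (degMon (n + 1) s) A) :
    IsLexSeg (degMon (n + 1) (s + 1)) (A.image (fun m => m + Pi.single 0 1)) := by
  constructor
  · intro x hx
    obtain ⟨a, ha, rfl⟩ := Finset.mem_image.1 hx
    exact S1mul_subset hA.1 (mem_S1mul.2 ⟨0, a, ha, rfl⟩)
  · intro m hm v hv hlt
    obtain ⟨a, ha, rfl⟩ := Finset.mem_image.1 hm
    have h0 := zero_le_of_lexLt hlt
    simp at h0
    obtain ⟨b, rfl⟩ : ∃ b : Fin (n + 1) → ℕ, v = b + Pi.single 0 1 := by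
      obtain ⟨b, hb⟩ := exists_sub v 0 0 (by omega)
      refine ⟨fun l => v l - (Pi.single 0 1 : Fin (n + 1) → ℕ) l, ?_⟩
      funext l
      by_cases h : l = 0
      · subst h; simp; omega
      · simp [h]
    refine Finset.mem_image.2 ⟨b, hA.2 a ha b ?_ ?_, rfl⟩
    · rw [mem_degMon, sum_add_single] at hv
      rw [mem_degMon]; omega
    · obtain ⟨k, hk, hk'⟩ := hlt
      refine ⟨k, fun j hj => ?_, ?_⟩
      · have := hk j hj
        simpa using this
      · simpa using hk'

theorem degMon_card_mono {n s : ℕ} : (degMon (n + 1) s).card ≤ (degMon (n + 1) (s + 1)).card := by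
  rw [← Finset.card_image_of_injective (degMon (n + 1) s) (shift_inj (Pi.single 0 1))]
  exact Finset.card_le_card (shift_isLexSeg ⟨subset_rfl, fun _ _ v hv _ => hv⟩).1

theorem growth_shift {n s d : ℕ} (h : d ≤ (degMon (n + 1) s).card) (r : ℕ) :
    d ≤ (degMon (n + 1) (s + r)).card ∧
    (S1mul (n + 1) (lexSeg (degMon (n + 1) (s + r)) d)).card =
      (S1mul (n + 1) (lexSeg (degMon (n + 1) s) d)).card := by
  induction r with
  | zero => exact ⟨h, rfl⟩
  | succ r ih =>
    obtain ⟨h1, h2⟩ := ih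
    refine ⟨h1.trans degMon_card_mono, ?_⟩
    rw [← h2]
    have hl := shift_isLexSeg (lexSeg_isLexSeg (degMon (n + 1) (s + r)) d)
    have e := lexSeg_card_self hl
    rw [Finset.card_image_of_injective _ (shift_inj _), lexSeg_card _ _ h1] at e
    rw [← add_assoc, e, S1mul_image_add, Finset.card_image_of_injective _ (shift_inj _)]

theorem le_degMon_card (n d : ℕ) : d ≤ (degMon (n + 2) d).card := by
  have : (Finset.range d).card ≤ (degMon (n + 2) d).card := by
    apply Finset.card_le_card_of_injOn
      (fun a => ins 0 a (ins 0 (d - a) (0 : Fin n → ℕ)))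
    · intro a ha
      simp at ha
      simp only [Finset.mem_coe]
      have e := mem_degMon.1 ((ins_mem (t := d - a) 0 (d - a) (0 : Fin n → ℕ)).2 (by simp))
      rw [ins_mem, e]
      omega
    · intro a _ b _ h
      have := congrFun h 0
      simpa only [ins_same] using this
  simpa using this

theorem growth_eq {k s d : ℕ} (h : d ≤ (degMon (k + 1) s).card) :
    growth d k = (S1mul (k + 1) (lexSeg (degMon (k + 1) s) d)).card := by
  have hd : d ≤ (degMon (k + 1) d).card := by
    rcases k with _ | k
    · have h1 : (degMon 1 s).card ≤ 1 := by
        rw [Finset.card_le_one]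
        intro a ha b hb
        rw [mem_degMon] at ha hb
        simp at ha hb
        funext j; rw [Subsingleton.elim j 0]; omega
      have h2 : 0 < (degMon 1 d).card :=
        Finset.card_pos.2 ⟨fun _ => d, by rw [mem_degMon]; simp⟩
      exact (h.trans h1).trans h2
    · exact le_degMon_card k d
  unfold growth
  rw [← (growth_shift hd s).2, ← (growth_shift h d).2, add_comm d s]

theorem x1exp_succ {n : ℕ} (m : Fin (n + 1) → ℕ) : x1exp m = m 0 := by
  simp [x1exp]

theorem clearX1_eq {n : ℕ} (m : Fin (n + 1) → ℕ) : clearX1 m = ins 0 0 (rem 0 m) := by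
  apply ext_at 0
  · rw [ins_same]; simp [clearX1]
  · intro j; rw [ins_succAbove]; simp [clearX1, rem]

theorem divX1_comp {n : ℕ} (M : Finset (Fin (n + 1) → ℕ)) (i : ℕ) :
    divX1 (comp M i) = (slc 0 M i).image (ins 0 0) := by
  rw [divX1, comp, slc, Finset.image_image]
  simp only [x1exp_succ]
  exact Finset.image_congr (fun m _ => clearX1_eq m)

theorem comp_card {n : ℕ} (M : Finset (Fin (n + 1) → ℕ)) (i : ℕ) :
    (comp M i).card = (slc 0 M i).card := by
  rw [slc_card, comp]; simp only [x1exp_succ]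

theorem ins0_inj {n : ℕ} : Function.Injective (ins (n := n) 0 0) := fun _ _ h => ins_inj 0 0 h

theorem S1'mul_image {n : ℕ} (A : Finset (Fin n → ℕ)) :
    S1'mul (n + 1) (A.image (ins 0 0)) = (S1mul n A).image (ins 0 0) := by
  ext x
  simp only [S1'mul, Finset.mem_biUnion, Finset.mem_filter, Finset.mem_univ, true_and,
    Finset.mem_image, mem_S1mul]
  constructor
  · rintro ⟨j, hj, _, ⟨a, ha, rfl⟩, rfl⟩
    rcases Fin.eq_self_or_eq_succAbove 0 j with rfl | ⟨k, rfl⟩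
    · simp at hj
    · exact ⟨_, ⟨k, a, ha, rfl⟩, (ins_add_ne _ _ _ _).symm⟩
  · rintro ⟨_, ⟨k, a, ha, rfl⟩, rfl⟩
    exact ⟨Fin.succAbove 0 k, by simp, _, ⟨a, ha, rfl⟩, ins_add_ne _ _ _ _⟩

theorem SpMon_eq {n s : ℕ} : SpMon (n + 1) s = (degMon n s).image (ins 0 0) := by
  ext x
  simp only [SpMon, Finset.mem_filter, x1exp_succ, Finset.mem_image]
  constructor
  · rintro ⟨h, h0⟩
    refine ⟨rem 0 x, ?_, by have e := ins_rem 0 x; rw [h0] at e; exact e⟩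
    rw [← ins_rem 0 x, ins_mem, h0] at h
    rw [mem_degMon]; omega
  · rintro ⟨a, ha, rfl⟩
    rw [ins_mem, ins_same, mem_degMon.1 ha]
    simp

theorem lexSeg_image {n : ℕ} {G : Finset (Fin n → ℕ)} {d : ℕ} (h : d ≤ G.card) :
    lexSeg (G.image (ins 0 0)) d = (lexSeg G d).image (ins 0 0) := by
  have hl := lexSeg_isLexSeg G d
  have : IsLexSeg (G.image (ins 0 0)) ((lexSeg G d).image (ins 0 0)) := by
    refine ⟨Finset.image_subset_image hl.1, ?_⟩
    intro m hm v hv hlt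
    obtain ⟨a, ha, rfl⟩ := Finset.mem_image.1 hm
    obtain ⟨b, hb, rfl⟩ := Finset.mem_image.1 hv
    exact Finset.mem_image_of_mem _ (hl.2 a ha b hb (ins_lex' 0 0 hlt))
  have e := lexSeg_card_self this
  rwa [Finset.card_image_of_injective _ ins0_inj, lexSeg_card _ _ h] at e

theorem main_aux (k t i : ℕ) (M : Finset (Fin (k + 2) → ℕ)) (hM : M ⊆ degMon (k + 2) t)
    (hG : GotzmannS (k + 2) t M) (hi : i ≤ t)
    (hcond : (if i = 0 then 0 else (comp M (i - 1)).card) ≤ growth ((comp M i).card) k) :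
    GotzmannSp (k + 2) (t - i) (divX1 (comp M i)) := by
  have hsub := slc_subset 0 hM i
  have hle := Finset.card_le_card hsub
  have hmac := mac_all (k + 1)
  simp only [comp_card] at hcond
  rw [growth_eq hle] at hcond
  unfold GotzmannSp
  rw [divX1_comp, SpMon_eq, Finset.card_image_of_injective _ ins0_inj, lexSeg_image hle,
    S1'mul_image, S1'mul_image, Finset.card_image_of_injective _ ins0_inj,
    Finset.card_image_of_injective _ ins0_inj]
  refine le_antisymm (hmac _ _ hsub) ?_
  have h1 := mac_all (k + 2) t (cmpr 0 t M) (cmpr_subset _ _ _)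
  rw [cmpr_card 0 hM, hG] at h1
  have h2 := slc_S1_eq hmac 0 hM h1 i (by omega)
  rw [slc_S1_cmpr 0 hM, max_eq_left hcond] at h2
  rw [h2]
  apply Finset.card_le_card
  rcases i with _ | i
  · rw [slc_S1mul_zero]
  · rw [slc_S1mul_succ]; exact Finset.subset_union_left

/-- Let `M` be a Gotzmann set of degree-`t` monomials in `S`, and
`d_i = |M^i|` (with `d_{-1} = 0`).  If `d_i^{<n-2>} ≥ d_{i-1}` for some `0 ≤ i ≤ t`,
then `M^i / x_1` is a Gotzmann set of degree-`(t-i)` monomials in `S' = F[x_2,...,x_n]`. -/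
theorem stmt_10 (n t i : ℕ) (hn : 2 ≤ n) (M : Finset (Fin n → ℕ)) (hM : M ⊆ degMon n t)
    (hG : GotzmannS n t M) (hi : i ≤ t)
    (hcond : (if i = 0 then 0 else (comp M (i - 1)).card)
      ≤ growth ((comp M i).card) (n - 2)) :
    GotzmannSp n (t - i) (divX1 (comp M i)) := by
  obtain ⟨k, rfl⟩ : ∃ k, n = k + 2 := ⟨n - 2, by omega⟩
  exact main_aux k t i M hM hG hi hcond
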